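/- For every k ≥ 1, there exists a 1-approximately submodular function f : 2^[n_k] → ℝ with n_k = k(k+3)/2 whose distance to every submodular function exceeds √(n_k/8) − 3/8. -/

import Mathlib

/-- at most the top block touched by `S` contains several elements of `S` -/
def GoodSet {n : ℕ} (blk : Fin n → ℕ) (S : Finset (Fin n)) : Prop :=
  ∀ x ∈ S, ∀ y ∈ S, ∀ z ∈ S, x ≠ y → blk x = blk y → blk z ≤ blk x

open Classical in
noncomputable def badF {n : ℕ} (blk : Fin n → ℕ) (S : Finset (Fin n)) : ℝ :=
  if GoodSet blk S then -((S.image blk).card : ℝ) else -(2 : ℝ) ^ S.card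

lemma badF_nonpos {n : ℕ} (blk : Fin n → ℕ) (S : Finset (Fin n)) : badF blk S ≤ 0 := by
  unfold badF
  split_ifs
  · simp
  · simp

lemma badF_lower {n : ℕ} (blk : Fin n → ℕ) (S : Finset (Fin n)) :
    -(2 : ℝ) ^ S.card ≤ badF blk S := by
  unfold badF
  split_ifs
  · have h1 : (S.image blk).card ≤ 2 ^ S.card :=
      Finset.card_image_le.trans Nat.lt_two_pow_self.le
    have h2 : ((S.image blk).card : ℝ) ≤ 2 ^ S.card := by exact_mod_cast h1
    linarith
  · exact le_rfl

lemma badF_lower' {n : ℕ} (blk : Fin n → ℕ) (S T : Finset (Fin n)) (h : S ⊂ T) :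
    -(2 : ℝ) ^ T.card ≤ 2 * badF blk S := by
  have h1 := badF_lower blk S
  have h2 : (2 : ℝ) ^ (S.card + 1) ≤ 2 ^ T.card :=
    pow_le_pow_right₀ (by norm_num) (Finset.card_lt_card h)
  rw [pow_succ] at h2
  linarith

lemma badF_approx {n : ℕ} (blk : Fin n → ℕ) (A B : Finset (Fin n)) :
    badF blk A + badF blk B ≥ badF blk (A ∪ B) + badF blk (A ∩ B) - 1 := by
  by_cases hAB : A ⊆ B
  · rw [Finset.union_eq_right.2 hAB, Finset.inter_eq_left.2 hAB]; linarith
  by_cases hBA : B ⊆ A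
  · rw [Finset.union_eq_left.2 hBA, Finset.inter_eq_right.2 hBA]; linarith
  by_cases hg : GoodSet blk (A ∪ B)
  · have gsub : ∀ S ⊆ A ∪ B, GoodSet blk S := fun S hS x hx y hy z hz =>
      hg x (hS hx) y (hS hy) z (hS hz)
    have gA := gsub A Finset.subset_union_left
    have gB := gsub B Finset.subset_union_right
    have gI := gsub (A ∩ B) (Finset.inter_subset_left.trans Finset.subset_union_left)
    have key : (A.image blk ∩ B.image blk).card ≤ ((A ∩ B).image blk).card + 1 := by
      by_cases hs : A.image blk ∩ B.image blk ⊆ (A ∩ B).image blk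
      · exact (Finset.card_le_card hs).trans (Nat.le_succ _)
      · obtain ⟨i, hi, hi'⟩ := Finset.not_subset.1 hs
        have ex : ∀ j ∈ A.image blk ∩ B.image blk, j ∉ (A ∩ B).image blk →
            ∃ x ∈ A ∪ B, ∃ y ∈ A ∪ B, x ≠ y ∧ blk x = j ∧ blk y = j := by
          intro j hj hj'
          simp only [Finset.mem_inter, Finset.mem_image] at hj hj'
          obtain ⟨⟨x, hx, hxj⟩, ⟨y, hy, hyj⟩⟩ := hj
          refine ⟨x, Finset.mem_union_left _ hx, y, Finset.mem_union_right _ hy, ?_, hxj, hyj⟩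
          rintro rfl
          exact hj' ⟨x, ⟨hx, hy⟩, hxj⟩
        have hsub : A.image blk ∩ B.image blk ⊆ insert i ((A ∩ B).image blk) := by
          intro j hj
          by_cases hj' : j ∈ (A ∩ B).image blk
          · exact Finset.mem_insert_of_mem hj'
          · obtain ⟨x, hx, y, hy, hxy, h1, h2⟩ := ex i hi hi'
            obtain ⟨x', hx', y', hy', hxy', h1', h2'⟩ := ex j hj hj'
            have a1 := hg x hx y hy x' hx' hxy (h1.trans h2.symm)
            have a2 := hg x' hx' y' hy' x hx hxy' (h1'.trans h2'.symm)
            have : j = i := by omega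
            simp [this]
        exact (Finset.card_le_card hsub).trans (Finset.card_insert_le _ _)
    have h2 := Finset.card_union_add_card_inter (A.image blk) (B.image blk)
    rw [← Finset.image_union] at h2
    have h3 : (A.image blk).card + (B.image blk).card ≤
        ((A ∪ B).image blk).card + ((A ∩ B).image blk).card + 1 := by omega
    have h4 : ((A.image blk).card : ℝ) + (B.image blk).card ≤
        ((A ∪ B).image blk).card + ((A ∩ B).image blk).card + 1 := by exact_mod_cast h3
    simp only [badF, if_pos gA, if_pos gB, if_pos gI, if_pos hg]
    linarith
  · have hU : badF blk (A ∪ B) = -(2 : ℝ) ^ (A ∪ B).card := by simp [badF, hg]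
    have hI := badF_nonpos blk (A ∩ B)
    have h1 := badF_lower' blk A (A ∪ B)
      ⟨Finset.subset_union_left, fun h => hBA (Finset.subset_union_right.trans h)⟩
    have h2 := badF_lower' blk B (A ∪ B)
      ⟨Finset.subset_union_right, fun h => hAB (Finset.subset_union_left.trans h)⟩
    linarith

lemma star_ineq {n : ℕ} (g : Finset (Fin n) → ℝ)
    (hg : ∀ A B, g A + g B ≥ g (A ∪ B) + g (A ∩ B)) (X T : Finset (Fin n)) (h : Disjoint X T) :
    g (X ∪ T) + ((T.card : ℝ) - 1) * g X ≤ ∑ w ∈ T, g (insert w X) := by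
  induction T using Finset.induction_on with
  | empty => simp
  | insert w T hw ih =>
    rw [Finset.disjoint_insert_right] at h
    have ih := ih h.2
    rw [Finset.sum_insert hw, Finset.card_insert_of_notMem hw]
    have := hg (X ∪ T) (insert w X)
    have e1 : X ∪ T ∪ insert w X = X ∪ insert w T := by ext; simp; tauto
    have e2 : (X ∪ T) ∩ insert w X = X := by
      ext z
      simp only [Finset.mem_inter, Finset.mem_union, Finset.mem_insert]
      constructor
      · rintro ⟨h1, rfl | h2⟩
        · tauto
        · exact h2
      · tauto
    rw [e1, e2] at this
    push_cast
    linarith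

lemma chain_exists {n : ℕ} (k : ℕ) (blk : Fin n → ℕ)
    (hc : ∀ i < k, (Finset.univ.filter (fun x => blk x = i)).card = i + 2)
    (g : Finset (Fin n) → ℝ) (hg : ∀ A B, g A + g B ≥ g (A ∪ B) + g (A ∩ B)) (d : ℝ)
    (hd : ∀ S, |badF blk S - g S| ≤ d) (i : ℕ) (hi : i ≤ k) :
    ∃ X : Finset (Fin n), (∀ x ∈ X, blk x < i) ∧ (X.image blk) = Finset.range i ∧
      Set.InjOn blk X ∧ -(i : ℝ) / 2 - d ≤ g X := by
  induction i with
  | zero =>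
    refine ⟨∅, by simp, by simp, by simp, ?_⟩
    have := (abs_le.1 (hd ∅)).2
    have h0 : badF blk ∅ = 0 := by simp [badF, GoodSet]
    rw [h0] at this
    simp
    linarith
  | succ i ih =>
    obtain ⟨X, hlt, him, hinj, hX⟩ := ih (by omega)
    set V := Finset.univ.filter (fun x => blk x = i) with hV
    have hVc : V.card = i + 2 := hc i (by omega)
    have hVm : ∀ x, x ∈ V ↔ blk x = i := by simp [hV]
    have hdis : Disjoint X V := Finset.disjoint_left.2 fun x hx hx' => by
      have := hlt x hx
      have := (hVm x).1 hx'
      omega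
    have hstar := star_ineq g hg X V hdis
    have hVne : V.Nonempty := Finset.card_pos.1 (by omega)
    obtain ⟨w, hw, hmax⟩ := Finset.exists_max_image V (fun w => g (insert w X)) hVne
    have hsum : ∑ w ∈ V, g (insert w X) ≤ V.card * g (insert w X) := by
      simpa using Finset.sum_le_card_nsmul V (fun w => g (insert w X)) _ hmax
    have hgood : GoodSet blk (X ∪ V) := by
      intro x hx y hy z hz hxy hb
      rw [Finset.mem_union, hVm] at hx hy hz
      have hz' : blk z ≤ i := by
        rcases hz with hz | hz
        · exact (hlt z hz).le
        · exact hz.le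
      rcases hx with hx | hx
      · rcases hy with hy | hy
        · exact absurd (hinj hx hy hb) hxy
        · have := hlt x hx; omega
      · omega
    have himV : (X ∪ V).image blk = Finset.range (i + 1) := by
      rw [Finset.image_union, him]
      have : V.image blk = {i} := by
        ext j
        simp only [Finset.mem_image, Finset.mem_singleton]
        constructor
        · rintro ⟨x, hx, rfl⟩
          exact (hVm x).1 hx
        · rintro rfl
          exact ⟨w, hw, (hVm w).1 hw⟩
      rw [this, Finset.range_add_one]
      ext; simp
    have hf : badF blk (X ∪ V) = -((i : ℝ) + 1) := by
      simp [badF, hgood, himV]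
    have hgV := (abs_le.1 (hd (X ∪ V))).2
    rw [hf] at hgV
    have hwb := (hVm w).1 hw
    refine ⟨insert w X, ?_, ?_, ?_, ?_⟩
    · intro x hx
      rcases Finset.mem_insert.1 hx with rfl | hx
      · omega
      · have := hlt x hx; omega
    · rw [Finset.image_insert, him, hwb, Finset.range_add_one]
    · intro x hx y hy hb
      simp only [Finset.coe_insert, Set.mem_insert_iff, Finset.mem_coe] at hx hy
      rcases hx with rfl | hx <;> rcases hy with rfl | hy
      · rfl
      · have := hlt y hy; omega
      · have := hlt x hx; omega
      · exact hinj hx hy hb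
    · rw [hVc] at hstar hsum
      push_cast at hstar hsum ⊢
      have hip : (0 : ℝ) ≤ (i : ℝ) + 1 := by positivity
      have hm := mul_le_mul_of_nonneg_left hX hip
      have hfin : ((i : ℝ) + 2) * (-((i : ℝ) + 1) / 2 - d) ≤ ((i : ℝ) + 2) * g (insert w X) := by
        nlinarith
      exact le_of_mul_le_mul_left hfin (by positivity)

lemma blk_exists (k : ℕ) : ∃ blk : Fin (k * (k + 3) / 2) → ℕ,
    ∀ i < k, (Finset.univ.filter (fun x => blk x = i)).card = i + 2 := by
  have hcard : Fintype.card (Σ i : Fin k, Fin (i.1 + 2)) = k * (k + 3) / 2 := by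
    rw [Fintype.card_sigma]
    simp only [Fintype.card_fin]
    rw [Fin.sum_univ_eq_sum_range (fun i => i + 2) k]
    have : ∀ m : ℕ, 2 * ∑ i ∈ Finset.range m, (i + 2) = m * (m + 3) := by
      intro m
      induction m with
      | zero => simp
      | succ m ih => rw [Finset.sum_range_succ, mul_add, ih]; ring
    have := this k
    omega
  let e := (Fintype.equivFinOfCardEq hcard).symm
  refine ⟨fun x => (e x).1.1, fun i hi => ?_⟩
  rw [← Fintype.card_fin (i + 2), ← Finset.card_univ]
  symm
  refine Finset.card_bij (fun j _ => e.symm ⟨⟨i, hi⟩, j⟩) ?_ ?_ ?_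
  · intro j _; simp
  · intro a _ b _ h; simpa using h
  · intro x hx
    simp only [Finset.mem_filter, Finset.mem_univ, true_and] at hx
    obtain ⟨y, rfl⟩ := e.symm.surjective x
    obtain ⟨⟨a, ha⟩, b⟩ := y
    simp at hx
    subst hx
    exact ⟨b, Finset.mem_univ _, rfl⟩

theorem stmt_11 (k : ℕ) (hk : 1 ≤ k) :
    ∃ f : Finset (Fin (k * (k + 3) / 2)) → ℝ,
      (∀ A B, f A + f B ≥ f (A ∪ B) + f (A ∩ B) - 1) ∧
      ∀ g : Finset (Fin (k * (k + 3) / 2)) → ℝ,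
        (∀ A B, g A + g B ≥ g (A ∪ B) + g (A ∩ B)) →
        ∃ S, |f S - g S| > Real.sqrt ((k * (k + 3) / 2 : ℕ) / 8 : ℝ) - 3 / 8 := by
  obtain ⟨blk, hc⟩ := blk_exists k
  refine ⟨badF blk, badF_approx blk, fun g hg => ?_⟩
  by_contra! hcon
  obtain ⟨X, hlt, him, hinj, hX⟩ := chain_exists k blk hc g hg _ hcon k le_rfl
  have hgood : GoodSet blk X := fun x hx y hy z hz hxy hb => absurd (hinj hx hy hb) hxy
  have hf : badF blk X = -(k : ℝ) := by simp [badF, hgood, him]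
  have h1 := (abs_le.1 (hcon X)).1
  rw [hf] at h1
  have hs : Real.sqrt ((k * (k + 3) / 2 : ℕ) / 8 : ℝ) < k / 4 + 3 / 8 := by
    rw [Real.sqrt_lt' (by positivity)]
    have h2 : ((k * (k + 3) / 2 : ℕ) : ℝ) ≤ ((k * (k + 3) : ℕ) : ℝ) / 2 := Nat.cast_div_le
    push_cast at h2
    nlinarith
  linarith
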